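/- arXiv:1510.03459 — 2 statements merged into one kernel-verified Lean document; each statement's English description precedes it below -/
import Mathlib

section
/- Let 0 < q < 1 and x > 0. Then ((x+1)/(x+1/2))^{(x+1/2)(−((ln q)/(1−q))q^{x+1/2} + ψ_q(x+1/2))} · e^{q^x (q − √q)/(1−q)} ≤ Γ_q(x+1)/Γ_q(x+1/2) ≤ ((x+1)/(x+1/2))^{(x+1)(−((ln q)/(1−q))q^{x+1} + ψ_q(x+1))} · e^{q^x (q − √q)/(1−q)}. -/
/-- The `q`-extension of the Gamma function: for fixed `q ∈ (0,1)` and `x > 0`,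
`Γ_q(x) = (1-q)^{1-x} ∏_{n=0}^∞ (1-q^{n+1})/(1-q^{n+x})`. -/
noncomputable def qGamma (q x : ℝ) : ℝ :=
  (1 - q) ^ (1 - x) * ∏' n : ℕ, (1 - q ^ (n + 1)) / (1 - q ^ ((n : ℝ) + x))

/-- The `q`-extension of the digamma function:
`ψ_q(x) = -ln(1-q) + (ln q) ∑_{n=1}^∞ q^{n x}/(1-q^n)`. -/
noncomputable def qDigamma (q x : ℝ) : ℝ :=
  -Real.log (1 - q) + Real.log q * ∑' n : ℕ, q ^ (((n : ℝ) + 1) * x) / (1 - q ^ (n + 1))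

open Set in
/-- If `t` times the derivative of `D` at `t` is monotone on `[a, b] ⊆ (0, ∞)`, the increment of
`D` is comparable with the increment of the logarithm. -/
theorem sub_bounds_of_monotoneOn_mul_deriv {D h : ℝ → ℝ} {a b : ℝ} (ha : 0 < a) (hab : a ≤ b)
    (hD : ∀ t ∈ Icc a b, HasDerivAt D (h t / t) t) (hh : MonotoneOn h (Icc a b)) :
    h a * (Real.log b - Real.log a) ≤ D b - D a ∧
      D b - D a ≤ h b * (Real.log b - Real.log a) := by
  have haI : a ∈ Icc a b := left_mem_Icc.2 hab
  have hbI : b ∈ Icc a b := right_mem_Icc.2 hab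
  have key (c : ℝ) : ∀ t ∈ Icc a b,
      HasDerivAt (fun t => D t - c * Real.log t) ((h t - c) / t) t := fun t ht => by
    have ht0 : t ≠ 0 := (ha.trans_le ht.1).ne'
    refine ((hD t ht).sub ((Real.hasDerivAt_log ht0).const_mul c)).congr_deriv ?_
    rw [sub_div, div_eq_mul_inv c]
  have hmono : MonotoneOn (fun t => D t - h a * Real.log t) (Icc a b) := by
    refine monotoneOn_of_deriv_nonneg (convex_Icc a b)
      (fun t ht => (key _ t ht).continuousAt.continuousWithinAt)
      (fun t ht => (key _ t (interior_subset ht)).differentiableAt.differentiableWithinAt)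
      fun t ht => ?_
    have ht' := interior_subset ht
    rw [(key _ t ht').deriv]
    exact div_nonneg (sub_nonneg.2 (hh haI ht' ht'.1)) (ha.le.trans ht'.1)
  have hanti : AntitoneOn (fun t => D t - h b * Real.log t) (Icc a b) := by
    refine antitoneOn_of_deriv_nonpos (convex_Icc a b)
      (fun t ht => (key _ t ht).continuousAt.continuousWithinAt)
      (fun t ht => (key _ t (interior_subset ht)).differentiableAt.differentiableWithinAt)
      fun t ht => ?_
    have ht' := interior_subset ht
    rw [(key _ t ht').deriv]
    exact div_nonpos_of_nonpos_of_nonneg (sub_nonpos.2 (hh ht' hbI ht'.2)) (ha.le.trans ht'.1)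
  have h1 := hmono haI hbI hab
  have h2 := hanti haI hbI hab
  simp only at h1 h2
  constructor <;> linarith

theorem rpow_succ_mul {q : ℝ} (hq : 0 ≤ q) (n : ℕ) (t : ℝ) :
    q ^ (((n : ℝ) + 1) * t) = (q ^ t) ^ (n + 1) := by
  rw [mul_comm, Real.rpow_mul hq, ← Nat.cast_succ, Real.rpow_natCast]

theorem one_sub_le_one_sub_pow_succ {q : ℝ} (hq0 : 0 ≤ q) (hq1 : q ≤ 1) (n : ℕ) :
    1 - q ≤ 1 - q ^ (n + 1) :=
  sub_le_sub_left (pow_le_of_le_one hq0 hq1 n.succ_ne_zero) 1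

theorem summable_pow_succ_div_one_sub_pow {q w : ℝ} (hq0 : 0 ≤ q) (hq1 : q < 1) (hw0 : 0 ≤ w)
    (hw1 : w < 1) : Summable fun n : ℕ => w ^ (n + 1) / (1 - q ^ (n + 1)) := by
  have h := ((summable_nat_add_iff 1).2 (summable_geometric_of_lt_one hw0 hw1)).div_const (1 - q)
  refine h.of_nonneg_of_le (fun n => ?_) fun n => ?_
  · have := one_sub_le_one_sub_pow_succ hq0 hq1.le n
    exact div_nonneg (by positivity) (by linarith)
  · have := one_sub_le_one_sub_pow_succ hq0 hq1.le n
    have : 0 < 1 - q := by linarith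
    gcongr

/-- The power series in `q ^ x` occurring in `log (Γ_q(x))`. -/
noncomputable def qLogGammaSeries (q x : ℝ) : ℝ :=
  ∑' m : ℕ, (q ^ x) ^ (m + 1) / (((m : ℝ) + 1) * (1 - q ^ (m + 1)))

theorem summable_qLogGammaSeries {q x : ℝ} (hq0 : 0 < q) (hq1 : q < 1) (hx : 0 < x) :
    Summable fun m : ℕ => (q ^ x) ^ (m + 1) / (((m : ℝ) + 1) * (1 - q ^ (m + 1))) := by
  have hw0 := Real.rpow_pos_of_pos hq0 x
  have h := summable_pow_succ_div_one_sub_pow hq0.le hq1 hw0.le (Real.rpow_lt_one hq0.le hq1 hx)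
  refine h.of_nonneg_of_le (fun n => ?_) fun n => ?_
  all_goals
    have := one_sub_le_one_sub_pow_succ hq0.le hq1.le n
    have : 0 < 1 - q ^ (n + 1) := by linarith
  · positivity
  · gcongr
    exact le_mul_of_one_le_left this.le (by linarith [(Nat.cast_nonneg n : (0 : ℝ) ≤ n)])

theorem hasSum_neg_log_one_sub_rpow {q x : ℝ} (hq0 : 0 < q) (hq1 : q < 1) (hx : 0 < x) :
    HasSum (fun n : ℕ => -Real.log (1 - q ^ ((n : ℝ) + x))) (qLogGammaSeries q x) := by
  have hw0 := Real.rpow_pos_of_pos hq0 x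
  let a : ℕ × ℕ → ℝ := fun p => (q ^ ((p.2 : ℝ) + x)) ^ (p.1 + 1) / ((p.1 : ℝ) + 1)
  have ha0 : 0 ≤ a := fun p => by
    have := Real.rpow_pos_of_pos hq0 ((p.2 : ℝ) + x)
    simp only [a, Pi.zero_apply]
    positivity
  have hrow (m : ℕ) : HasSum (fun n => a (m, n))
      ((q ^ x) ^ (m + 1) / (((m : ℝ) + 1) * (1 - q ^ (m + 1)))) := by
    have hg := (hasSum_geometric_of_lt_one (by positivity)
      (pow_lt_one₀ hq0.le hq1 (Nat.add_one_ne_zero m))).mul_left ((q ^ x) ^ (m + 1) / ((m : ℝ) + 1))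
    rw [← div_eq_mul_inv, div_div] at hg
    refine hg.congr_fun fun n => ?_
    simp only [a, Real.rpow_add hq0, Real.rpow_natCast, mul_pow]
    ring
  have hcol (n : ℕ) : HasSum (fun m => a (m, n)) (-Real.log (1 - q ^ ((n : ℝ) + x))) := by
    have h : |q ^ ((n : ℝ) + x)| < 1 := by
      rw [abs_of_pos (Real.rpow_pos_of_pos hq0 _)]
      exact Real.rpow_lt_one hq0.le hq1 (by positivity)
    simpa only [a] using Real.hasSum_pow_div_log_of_abs_lt_one h
  have hsum : Summable a := by
    rw [summable_prod_of_nonneg ha0]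
    refine ⟨fun m => (hrow m).summable, ?_⟩
    simpa only [(hrow _).tsum_eq] using summable_qLogGammaSeries hq0 hq1 hx
  have htot : HasSum a (qLogGammaSeries q x) := by
    convert hsum.hasSum using 1
    rw [hsum.tsum_prod' fun m => (hrow m).summable]
    simp only [(hrow _).tsum_eq, qLogGammaSeries]
  exact ((Equiv.prodComm ℕ ℕ).hasSum_iff.2 htot).prod_fiberwise hcol

theorem qGamma_eq_exp {q x : ℝ} (hq0 : 0 < q) (hq1 : q < 1) (hx : 0 < x) :
    qGamma q x = Real.exp
      ((1 - x) * Real.log (1 - q) + (qLogGammaSeries q x - qLogGammaSeries q 1)) := by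
  have hpos (y : ℝ) (hy : 0 < y) (n : ℕ) : 0 < 1 - q ^ ((n : ℝ) + y) :=
    sub_pos.2 (Real.rpow_lt_one hq0.le hq1 (by positivity))
  have hlog : HasSum
      (fun n : ℕ => Real.log ((1 - q ^ (n + 1)) / (1 - q ^ ((n : ℝ) + x))))
      (qLogGammaSeries q x - qLogGammaSeries q 1) := by
    refine ((hasSum_neg_log_one_sub_rpow hq0 hq1 hx).sub
      (hasSum_neg_log_one_sub_rpow hq0 hq1 one_pos)).congr_fun fun n => ?_
    rw [← Real.rpow_natCast, Nat.cast_succ,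
      Real.log_div (hpos 1 one_pos n).ne' (hpos x hx n).ne']
    ring
  rw [qGamma, ← Real.rexp_tsum_eq_tprod _ hlog.summable, hlog.tsum_eq,
    Real.rpow_def_of_pos (sub_pos.2 hq1), ← Real.exp_add, mul_comm]
  intro n
  refine div_pos ?_ (hpos x hx n)
  exact sub_pos.2 (pow_lt_one₀ hq0.le hq1 n.succ_ne_zero)

open Set in
theorem hasDerivAt_qLogGammaSeries {q x : ℝ} (hq0 : 0 < q) (hq1 : q < 1) (hx : 0 < x) :
    HasDerivAt (qLogGammaSeries q)
      (Real.log q * ∑' n : ℕ, q ^ (((n : ℝ) + 1) * x) / (1 - q ^ (n + 1))) x := by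
  have hc : 0 < x / 2 := by positivity
  have hcx : x ∈ Ioi (x / 2) := half_lt_self hx
  have hu := (summable_pow_succ_div_one_sub_pow hq0.le hq1 (Real.rpow_pos_of_pos hq0 _).le
    (Real.rpow_lt_one hq0.le hq1 hc)).mul_left |Real.log q|
  rw [← tsum_mul_left]
  refine hasDerivAt_tsum_of_isPreconnected
    (g := fun (m : ℕ) z => (q ^ z) ^ (m + 1) / (((m : ℝ) + 1) * (1 - q ^ (m + 1))))
    (g' := fun (m : ℕ) z => Real.log q * (q ^ (((m : ℝ) + 1) * z) / (1 - q ^ (m + 1))))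
    hu isOpen_Ioi isPreconnected_Ioi
    (fun n y hy => ?_) (fun n y hy => ?_) hcx (summable_qLogGammaSeries hq0 hq1 hx) hcx
  · have hd := (((hasDerivAt_id y).const_mul ((n : ℝ) + 1)).const_rpow hq0).div_const
      (((n : ℝ) + 1) * (1 - q ^ (n + 1)))
    simp only [id, rpow_succ_mul hq0.le] at hd ⊢
    refine hd.congr_deriv ?_
    have : (n : ℝ) + 1 ≠ 0 := by positivity
    field_simp
  · have := one_sub_le_one_sub_pow_succ hq0.le hq1.le n
    have hpos : 0 < 1 - q ^ (n + 1) := by linarith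
    have hy0 := Real.rpow_pos_of_pos hq0 y
    rw [rpow_succ_mul hq0.le, norm_mul, Real.norm_eq_abs, Real.norm_of_nonneg (by positivity)]
    have : q ^ y ≤ q ^ (x / 2) := Real.rpow_le_rpow_of_exponent_ge hq0 hq1.le (le_of_lt hy)
    gcongr

/-- The `q`-digamma function with the terms `n = 1` and `k = 0` of
`∑_{n ≥ 1} ∑_{k ≥ 0} q ^ (n (x + k))` removed. -/
noncomputable def qDigammaTail (q x : ℝ) : ℝ :=
  -Real.log (1 - q) + Real.log q * ∑' n : ℕ, (q ^ x) ^ (n + 2) * q ^ (n + 2) / (1 - q ^ (n + 2))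

theorem summable_qDigammaTail {q x : ℝ} (hq0 : 0 < q) (hq1 : q < 1) (hx : 0 < x) :
    Summable fun n : ℕ => (q ^ x) ^ (n + 2) * q ^ (n + 2) / (1 - q ^ (n + 2)) := by
  have hw0 := Real.rpow_pos_of_pos hq0 x
  have hw1 := Real.rpow_lt_one hq0.le hq1 hx
  have h := (summable_nat_add_iff 1).2 (summable_pow_succ_div_one_sub_pow hq0.le hq1
    (mul_pos hw0 hq0).le (mul_lt_one_of_nonneg_of_lt_one_left hw0.le hw1 hq1.le))
  simpa only [mul_pow] using h

theorem qDigamma_eq_tail {q x : ℝ} (hq0 : 0 < q) (hq1 : q < 1) (hx : 0 < x) :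
    -(Real.log q / (1 - q)) * q ^ x + qDigamma q x =
      qDigammaTail q x + Real.log q * ((q ^ x) ^ 2 / (1 - q ^ x)) := by
  have hw0 := Real.rpow_pos_of_pos hq0 x
  have hw1 := Real.rpow_lt_one hq0.le hq1 hx
  have hS := summable_pow_succ_div_one_sub_pow hq0.le hq1 hw0.le hw1
  have hsq : HasSum (fun n : ℕ => (q ^ x) ^ (n + 2)) ((q ^ x) ^ 2 / (1 - q ^ x)) := by
    simpa only [pow_add, mul_comm, div_eq_mul_inv] using
      (hasSum_geometric_of_lt_one hw0.le hw1).mul_left ((q ^ x) ^ 2)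
  have hsplit : ∑' n : ℕ, (q ^ x) ^ (n + 2) / (1 - q ^ (n + 2)) =
      ∑' n : ℕ, (q ^ x) ^ (n + 2) * q ^ (n + 2) / (1 - q ^ (n + 2)) +
        (q ^ x) ^ 2 / (1 - q ^ x) := by
    rw [← hsq.tsum_eq, ← (summable_qDigammaTail hq0 hq1 hx).tsum_add hsq.summable]
    refine tsum_congr fun n => ?_
    have : 1 - q ^ (n + 2) ≠ 0 := (sub_pos.2 (pow_lt_one₀ hq0.le hq1 (by lia))).ne'
    field_simp
    ring
  simp only [qDigamma, qDigammaTail, rpow_succ_mul hq0.le]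
  rw [hS.tsum_eq_zero_add]
  simp only [add_assoc, Nat.reduceAdd, hsplit, zero_add, pow_one]
  ring

theorem qDigammaTail_mono {q x y : ℝ} (hq0 : 0 < q) (hq1 : q < 1) (hx : 0 < x) (hxy : x ≤ y) :
    qDigammaTail q x ≤ qDigammaTail q y := by
  refine add_le_add_right (mul_le_mul_of_nonpos_left ?_ (Real.log_neg hq0 hq1).le) _
  refine (summable_qDigammaTail hq0 hq1 (hx.trans_le hxy)).tsum_le_tsum (fun n => ?_)
    (summable_qDigammaTail hq0 hq1 hx)
  have : 0 < 1 - q ^ (n + 2) := sub_pos.2 (pow_lt_one₀ hq0.le hq1 (by lia))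
  have := Real.rpow_pos_of_pos hq0 y
  have : q ^ y ≤ q ^ x := Real.rpow_le_rpow_of_exponent_ge hq0 hq1.le hxy
  gcongr

theorem qDigammaTail_half_nonneg {q : ℝ} (hq0 : 0 < q) (hq1 : q < 1) :
    0 ≤ qDigammaTail q (1 / 2) := by
  set w := q ^ (1 / 2 : ℝ) with hw
  have hw0 : 0 < w := Real.rpow_pos_of_pos hq0 _
  have hw1 : w < 1 := Real.rpow_lt_one hq0.le hq1 (by norm_num)
  have hwq : q = w * w := by rw [hw, ← Real.rpow_add hq0]; norm_num
  have hlogS := Real.hasSum_pow_div_log_of_abs_lt_one (abs_lt.2 ⟨by linarith, hw1⟩)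
  have htail : HasSum (fun n : ℕ => w ^ (n + 2) / ((n : ℝ) + 2)) (-Real.log (1 - w) - w) := by
    have h := (hasSum_nat_add_iff' 1).2 hlogS
    simp only [Finset.range_one, Finset.sum_singleton, Nat.cast_zero, zero_add, pow_one,
      div_one] at h
    refine h.congr_fun fun n => ?_
    push_cast
    ring
  have hle : -Real.log q * ∑' n : ℕ, w ^ (n + 2) * q ^ (n + 2) / (1 - q ^ (n + 2)) ≤
      -Real.log (1 - w) - w := by
    rw [← tsum_mul_left, ← htail.tsum_eq]
    refine ((summable_qDigammaTail hq0 hq1 (by norm_num)).mul_left _).tsum_le_tsum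
      (fun n => ?_) htail.summable
    have hp : 0 < q ^ (n + 2) := by positivity
    have h1 : 0 < 1 - q ^ (n + 2) := sub_pos.2 (pow_lt_one₀ hq0.le hq1 (by lia))
    have hlog : -(((n : ℝ) + 2) * Real.log q) ≤ (q ^ (n + 2))⁻¹ - 1 := by
      have := Real.log_le_sub_one_of_pos (inv_pos.2 hp)
      rw [Real.log_inv, Real.log_pow] at this
      exact_mod_cast this
    have hkey : -(((n : ℝ) + 2) * Real.log q) * q ^ (n + 2) ≤ 1 - q ^ (n + 2) := by
      calc _ ≤ ((q ^ (n + 2))⁻¹ - 1) * q ^ (n + 2) := by gcongr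
        _ = _ := by field_simp
    rw [← mul_div_assoc, div_le_div_iff₀ h1 (by positivity)]
    calc _ = w ^ (n + 2) * (-(((n : ℝ) + 2) * Real.log q) * q ^ (n + 2)) := by ring
      _ ≤ _ := by gcongr
  have hfac : Real.log (1 - q) = Real.log (1 - w) + Real.log (1 + w) := by
    rw [← Real.log_mul (by linarith) (by linarith), hwq]
    congr 1
    ring
  have hlog1 := Real.log_le_sub_one_of_pos (show 0 < 1 + w by linarith)
  simp only [qDigammaTail, ← hw]
  linarith

theorem mul_exp_neg_two_mul_div_antitone {s r : ℝ} (hs : 0 < s) (hsr : s ≤ r) :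
    r * (Real.exp (-r) ^ 2 / (1 - Real.exp (-r))) ≤
      s * (Real.exp (-s) ^ 2 / (1 - Real.exp (-s))) := by
  have hrw {y : ℝ} (hy : 0 < y) : y * (Real.exp (-y) ^ 2 / (1 - Real.exp (-y))) =
      Real.exp (-y) * ((Real.exp y - 1) / y)⁻¹ := by
    have h1 : Real.exp y - 1 ≠ 0 := by have := Real.add_one_lt_exp hy.ne'; linarith
    rw [Real.exp_neg]
    have := Real.exp_pos y
    have h2 : 1 - (Real.exp y)⁻¹ ≠ 0 := by
      rw [← Real.exp_neg, sub_ne_zero]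
      exact (Real.exp_lt_one_iff.2 (neg_neg_of_pos hy)).ne'
    field_simp
  have hr : 0 < r := hs.trans_le hsr
  have hsec : (Real.exp s - 1) / s ≤ (Real.exp r - 1) / r := by
    simpa using convexOn_exp.secant_mono (Set.mem_univ 0) (Set.mem_univ s) (Set.mem_univ r)
      hs.ne' hr.ne' hsr
  have hpos : 0 < (Real.exp s - 1) / s :=
    div_pos (by have := Real.add_one_lt_exp hs.ne'; linarith) hs
  rw [hrw hs, hrw hr]
  have := hpos.trans_le hsec
  gcongr

open Set in
theorem monotoneOn_mul_qDigamma {q : ℝ} (hq0 : 0 < q) (hq1 : q < 1) :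
    MonotoneOn (fun t => t * (-(Real.log q / (1 - q)) * q ^ t + qDigamma q t))
      (Ici (1 / 2)) := by
  intro a ha b hb hab
  have ha' : 1 / 2 ≤ a := ha
  have ha0 : 0 < a := by linarith
  have hb0 : 0 < b := by linarith
  have hL : 0 < -Real.log q := neg_pos.2 (Real.log_neg hq0 hq1)
  have h1 := qDigammaTail_mono hq0 hq1 ha0 hab
  have h2 := (qDigammaTail_half_nonneg hq0 hq1).trans
    (qDigammaTail_mono hq0 hq1 (by norm_num) ha')
  have h3 := mul_le_mul hab h1 h2 hb0.le
  have h4 := mul_exp_neg_two_mul_div_antitone (mul_pos hL ha0)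
    (mul_le_mul_of_nonneg_left hab hL.le)
  simp only [neg_mul, neg_neg, ← Real.rpow_def_of_pos hq0] at h4
  simp only [qDigamma_eq_tail hq0 hq1 ha0, qDigamma_eq_tail hq0 hq1 hb0]
  linarith

theorem qGamma_ratio_half_bounds (q x : ℝ) (hq0 : 0 < q) (hq1 : q < 1) (hx : 0 < x) :
    ((x + 1) / (x + 1/2)) ^
        ((x + 1/2) * (-(Real.log q / (1 - q)) * q ^ (x + 1/2) + qDigamma q (x + 1/2))) *
        Real.exp (q ^ x * (q - Real.sqrt q) / (1 - q)) ≤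
      qGamma q (x + 1) / qGamma q (x + 1/2) ∧
    qGamma q (x + 1) / qGamma q (x + 1/2) ≤
      ((x + 1) / (x + 1/2)) ^
        ((x + 1) * (-(Real.log q / (1 - q)) * q ^ (x + 1) + qDigamma q (x + 1))) *
        Real.exp (q ^ x * (q - Real.sqrt q) / (1 - q)) := by
  have ha : 0 < x + 1 / 2 := by positivity
  have hb : 0 < x + 1 := by positivity
  have hD : ∀ t ∈ Set.Icc (x + 1 / 2) (x + 1), HasDerivAt
      (fun t => -Real.log (1 - q) * t + qLogGammaSeries q t - q ^ t / (1 - q))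
      (t * (-(Real.log q / (1 - q)) * q ^ t + qDigamma q t) / t) t := fun t ht => by
    have ht0 : 0 < t := ha.trans_le ht.1
    have h := (((hasDerivAt_id t).const_mul (-Real.log (1 - q))).add
      (hasDerivAt_qLogGammaSeries hq0 hq1 ht0)).sub
      (((hasDerivAt_id t).const_rpow hq0).div_const (1 - q))
    refine h.congr_deriv ?_
    rw [mul_div_cancel_left₀ _ ht0.ne', qDigamma]
    simp only [id]
    ring
  obtain ⟨h1, h2⟩ := sub_bounds_of_monotoneOn_mul_deriv
    (h := fun t => t * (-(Real.log q / (1 - q)) * q ^ t + qDigamma q t)) ha (by linarith) hD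
    ((monotoneOn_mul_qDigamma hq0 hq1).mono fun t ht => Set.mem_Ici.2 (by linarith [ht.1]))
  have hexp : q ^ x * (q - Real.sqrt q) / (1 - q) =
      q ^ (x + 1) / (1 - q) - q ^ (x + 1 / 2) / (1 - q) := by
    rw [Real.rpow_add hq0, Real.rpow_add hq0, Real.rpow_one, Real.sqrt_eq_rpow]
    ring
  rw [qGamma_eq_exp hq0 hq1 hb, qGamma_eq_exp hq0 hq1 ha, ← Real.exp_sub,
    Real.rpow_def_of_pos (div_pos hb ha), Real.rpow_def_of_pos (div_pos hb ha), ← Real.exp_add,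
    ← Real.exp_add, Real.exp_le_exp, Real.exp_le_exp, Real.log_div hb.ne' ha.ne', hexp]
  constructor <;> linarith
end

section
/- Let 0 < q < 1 and x > 0. Then e^{(1/2)ψ_q(x+1/2)} < Γ_q(x+1)/Γ_q(x+1/2) < e^{(1/2)ψ_q(x+1)}. -/
/-- The double series behind `∑ₙ -log (1 - q ^ (n + y))`, indexed by `(m, n)`. -/
theorem summable_rpow_mul_add_div {q y : ℝ} (hq0 : 0 < q) (hq1 : q < 1) (hy : 0 < y) :
    Summable fun p : ℕ × ℕ ↦ q ^ (((p.1 : ℝ) + 1) * (p.2 + y)) / ((p.1 : ℝ) + 1) := by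
  have hgeom : Summable fun p : ℕ × ℕ ↦ (q ^ y) ^ p.1 * q ^ p.2 :=
    (summable_geometric_of_lt_one (by positivity)
      (Real.rpow_lt_one hq0.le hq1 hy)).mul_of_nonneg
      (summable_geometric_of_lt_one hq0.le hq1) (fun _ ↦ by positivity) (fun _ ↦ by positivity)
  refine hgeom.of_nonneg_of_le (fun _ ↦ by positivity) fun ⟨m, n⟩ ↦ ?_
  dsimp only
  rw [← Real.rpow_natCast (q ^ y), ← Real.rpow_mul hq0.le, ← Real.rpow_natCast q n,
    ← Real.rpow_add hq0]
  refine (div_le_self (by positivity) (by simp)).trans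
    (Real.rpow_le_rpow_of_exponent_ge hq0 hq1.le ?_)
  have : (0 : ℝ) ≤ m * n := by positivity
  nlinarith

theorem hasSum_rpow_mul_add_div {q : ℝ} (hq0 : 0 < q) (hq1 : q < 1) (y : ℝ) (m : ℕ) :
    HasSum (fun n : ℕ ↦ q ^ (((m : ℝ) + 1) * (n + y)) / ((m : ℝ) + 1))
      (q ^ (((m : ℝ) + 1) * y) / (((m : ℝ) + 1) * (1 - q ^ (m + 1)))) := by
  have h := (hasSum_geometric_of_lt_one (pow_nonneg hq0.le (m + 1))
    (pow_lt_one₀ hq0.le hq1 m.succ_ne_zero)).mul_left (q ^ (((m : ℝ) + 1) * y) / ((m : ℝ) + 1))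
  rw [div_mul_eq_div_div, div_eq_mul_inv _ (1 - _)]
  have hpow : q ^ ((m : ℝ) + 1) = q ^ (m + 1) := by exact_mod_cast Real.rpow_natCast q (m + 1)
  have hterm (n : ℕ) : q ^ (((m : ℝ) + 1) * (n + y)) / ((m : ℝ) + 1) =
      q ^ (((m : ℝ) + 1) * y) / ((m : ℝ) + 1) * (q ^ (m + 1)) ^ n := by
    rw [mul_add, Real.rpow_add hq0, Real.rpow_mul hq0.le _ (n : ℝ), Real.rpow_natCast, hpow]
    ring
  simpa only [hterm] using h

theorem hasSum_neg_log_one_sub_rpow_s5 {q y : ℝ} (hq0 : 0 < q) (hq1 : q < 1) (hy : 0 < y) :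
    HasSum (fun n : ℕ ↦ -Real.log (1 - q ^ ((n : ℝ) + y)))
      (∑' m : ℕ, q ^ (((m : ℝ) + 1) * y) / (((m : ℝ) + 1) * (1 - q ^ (m + 1)))) := by
  have hs := summable_rpow_mul_add_div hq0 hq1 hy
  have h₁ := hs.hasSum.prod_fiberwise (hasSum_rpow_mul_add_div hq0 hq1 y)
  rw [h₁.tsum_eq]
  refine (((Equiv.prodComm ℕ ℕ).hasSum_iff).mpr hs.hasSum).prod_fiberwise fun n ↦ ?_
  have hlt : q ^ ((n : ℝ) + y) < 1 := Real.rpow_lt_one hq0.le hq1 (by positivity)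
  have hpos : 0 < q ^ ((n : ℝ) + y) := by positivity
  convert Real.hasSum_pow_div_log_of_abs_lt_one (abs_lt.mpr ⟨by linarith, hlt⟩) using 1
  funext m
  simp only [Function.comp_apply, Equiv.prodComm_apply, Prod.swap_prod_mk]
  rw [← Real.rpow_natCast, ← Real.rpow_mul hq0.le]
  push_cast
  rw [mul_comm]

theorem summable_rpow_mul_div {q y : ℝ} (hq0 : 0 < q) (hq1 : q < 1) (hy : 0 < y) :
    Summable fun m : ℕ ↦ q ^ (((m : ℝ) + 1) * y) / (((m : ℝ) + 1) * (1 - q ^ (m + 1))) :=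
  ((summable_rpow_mul_add_div hq0 hq1 hy).hasSum.prod_fiberwise
    (hasSum_rpow_mul_add_div hq0 hq1 y)).summable

theorem summable_qDigamma {q y : ℝ} (hq0 : 0 < q) (hq1 : q < 1) (hy : 0 < y) :
    Summable fun m : ℕ ↦ q ^ (((m : ℝ) + 1) * y) / (1 - q ^ (m + 1)) := by
  have hr : q ^ y < 1 := Real.rpow_lt_one hq0.le hq1 hy
  have hgeom := (summable_geometric_of_lt_one (by positivity) hr).mul_left ((1 - q)⁻¹)
  have hpow (m : ℕ) : q ^ (m + 1) ≤ q := pow_le_of_le_one hq0.le hq1.le m.succ_ne_zero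
  refine hgeom.of_nonneg_of_le (fun m ↦ ?_) fun m ↦ ?_
  · exact div_nonneg (by positivity) (by linarith [hpow m])
  · rw [← Real.rpow_natCast (q ^ y), ← Real.rpow_mul hq0.le, div_eq_inv_mul]
    refine mul_le_mul (inv_anti₀ (by linarith) (by linarith [hpow m]))
      (Real.rpow_le_rpow_of_exponent_ge hq0 hq1.le (by nlinarith)) (by positivity)
      (inv_nonneg.mpr (by linarith))

theorem qGamma_eq_rpow_mul_exp {q y : ℝ} (hq0 : 0 < q) (hq1 : q < 1) (hy : 0 < y) :
    qGamma q y = (1 - q) ^ (1 - y) * Real.exp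
      ((∑' m : ℕ, q ^ (((m : ℝ) + 1) * y) / (((m : ℝ) + 1) * (1 - q ^ (m + 1)))) -
        ∑' m : ℕ, q ^ (((m : ℝ) + 1) * 1) / (((m : ℝ) + 1) * (1 - q ^ (m + 1)))) := by
  have hden (z : ℝ) (hz : 0 < z) (n : ℕ) : 0 < 1 - q ^ ((n : ℝ) + z) :=
    sub_pos.mpr (Real.rpow_lt_one hq0.le hq1 (by positivity))
  have hcast (n : ℕ) : q ^ ((n : ℝ) + 1) = q ^ (n + 1) := by
    exact_mod_cast Real.rpow_natCast q (n + 1)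
  have h := ((hasSum_neg_log_one_sub_rpow_s5 hq0 hq1 hy).sub
    (hasSum_neg_log_one_sub_rpow_s5 hq0 hq1 one_pos)).rexp
  have hfun : (Real.exp ∘ fun n : ℕ ↦ -Real.log (1 - q ^ ((n : ℝ) + y)) -
      -Real.log (1 - q ^ ((n : ℝ) + 1))) =
      fun n : ℕ ↦ (1 - q ^ (n + 1)) / (1 - q ^ ((n : ℝ) + y)) := by
    funext n
    rw [Function.comp_apply, neg_sub_neg, Real.exp_sub, Real.exp_log (hden 1 one_pos n),
      Real.exp_log (hden y hy n), hcast]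
  rw [hfun] at h
  rw [qGamma, h.tprod_eq]

theorem qGamma_div_qGamma {q x y : ℝ} (hq0 : 0 < q) (hq1 : q < 1) (hx : 0 < x) (hy : 0 < y) :
    qGamma q y / qGamma q x = Real.exp ((x - y) * Real.log (1 - q) +
      ∑' m : ℕ, (q ^ (((m : ℝ) + 1) * y) - q ^ (((m : ℝ) + 1) * x)) /
        (((m : ℝ) + 1) * (1 - q ^ (m + 1)))) := by
  have h1q : 0 < 1 - q := sub_pos.mpr hq1
  simp_rw [sub_div]
  rw [(summable_rpow_mul_div hq0 hq1 hy).tsum_sub (summable_rpow_mul_div hq0 hq1 hx),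
    qGamma_eq_rpow_mul_exp hq0 hq1 hx, qGamma_eq_rpow_mul_exp hq0 hq1 hy,
    Real.rpow_def_of_pos h1q, Real.rpow_def_of_pos h1q, ← Real.exp_add, ← Real.exp_add,
    ← Real.exp_sub]
  ring_nf

theorem log_mul_rpow_lt_rpow_sub_rpow {q x y : ℝ} (hq0 : 0 < q) (hq1 : q < 1) (hxy : x ≠ y) :
    (y - x) * Real.log q * q ^ x < q ^ y - q ^ x := by
  have hne : q ^ (y - x) ≠ 1 := fun h ↦ by
    have := congrArg Real.log h
    rw [Real.log_rpow hq0, Real.log_one] at this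
    exact mul_ne_zero (sub_ne_zero.mpr hxy.symm) (Real.log_neg hq0 hq1).ne this
  have h := Real.log_lt_sub_one_of_pos (Real.rpow_pos_of_pos hq0 (y - x)) hne
  rw [Real.log_rpow hq0] at h
  calc (y - x) * Real.log q * q ^ x < (q ^ (y - x) - 1) * q ^ x := by gcongr
    _ = q ^ y - q ^ x := by rw [sub_mul, ← Real.rpow_add hq0, sub_add_cancel, one_mul]

theorem log_mul_rpow_div_lt {q x y : ℝ} (hq0 : 0 < q) (hq1 : q < 1) (hxy : x ≠ y) (m : ℕ) :
    (y - x) * Real.log q * (q ^ (((m : ℝ) + 1) * x) / (1 - q ^ (m + 1))) <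
      (q ^ (((m : ℝ) + 1) * y) - q ^ (((m : ℝ) + 1) * x)) /
        (((m : ℝ) + 1) * (1 - q ^ (m + 1))) := by
  have hm : (0 : ℝ) < m + 1 := by positivity
  have hd : 0 < 1 - q ^ (m + 1) := sub_pos.mpr (pow_lt_one₀ hq0.le hq1 m.succ_ne_zero)
  rw [← mul_div_assoc, ← mul_div_mul_left _ _ hm.ne']
  gcongr
  have h := log_mul_rpow_lt_rpow_sub_rpow hq0 hq1 (fun h ↦ hxy (mul_left_cancel₀ hm.ne' h) :
    ((m : ℝ) + 1) * x ≠ ((m : ℝ) + 1) * y)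
  linarith

theorem exp_mul_qDigamma_lt_qGamma_div {q x y : ℝ} (hq0 : 0 < q) (hq1 : q < 1)
    (hx : 0 < x) (hy : 0 < y) (hxy : x ≠ y) :
    Real.exp ((y - x) * qDigamma q x) < qGamma q y / qGamma q x := by
  rw [qGamma_div_qGamma hq0 hq1 hx hy, Real.exp_lt_exp, qDigamma]
  have hs := ((summable_rpow_mul_div hq0 hq1 hy).sub (summable_rpow_mul_div hq0 hq1 hx))
  simp_rw [← sub_div] at hs
  have h := Summable.tsum_lt_tsum (i := 0) (fun m ↦ (log_mul_rpow_div_lt hq0 hq1 hxy m).le)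
    (log_mul_rpow_div_lt hq0 hq1 hxy 0)
    ((summable_qDigamma hq0 hq1 hx).mul_left ((y - x) * Real.log q)) hs
  rw [tsum_mul_left] at h
  linarith

theorem qGamma_ratio_exp_bounds_half (q x : ℝ) (hq0 : 0 < q) (hq1 : q < 1) (hx : 0 < x) :
    Real.exp ((1/2) * qDigamma q (x + 1/2)) < qGamma q (x + 1) / qGamma q (x + 1/2) ∧
    qGamma q (x + 1) / qGamma q (x + 1/2) < Real.exp ((1/2) * qDigamma q (x + 1)) := by
  have hh : 0 < x + 1 / 2 := by positivity
  have h1 : 0 < x + 1 := by positivity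
  constructor
  · convert exp_mul_qDigamma_lt_qGamma_div hq0 hq1 hh h1 (by norm_num) using 3
    ring
  · have h := exp_mul_qDigamma_lt_qGamma_div hq0 hq1 h1 hh (by norm_num)
    rw [show x + 1 / 2 - (x + 1) = -(1 / 2) by ring, neg_mul, Real.exp_neg, ← inv_div (qGamma q (x + 1))] at h
    refine (inv_lt_inv₀ (Real.exp_pos _) ?_).mp h
    rw [qGamma_div_qGamma hq0 hq1 hh h1]
    exact Real.exp_pos _
end
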